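/- Let c₁, c₂ > 0 with 2c₁ − 2c₂ − 1 > 0, and let f(s) = ∑_{n≥1} a_n n^{-s} with ∑|a_n|² < ∞. For k ≥ 0 set b_k = ((−c₂)^k / k!) · ∑_{n≥1} a_n n^{-c₁} (log n)^{k+1}. Then for every integer N ≥ 0, ∑_{k=N}^∞ |b_k|² ≤ (2c₁/(2c₁−1)³) · ∑_{k=N}^∞ (2c₂/(2c₁−1))^{2k} (2k+2)² · ∑_{n≥1}|a_n|². -/

import Mathlib

open MeasureTheory Set in
theorem integral_pow_mul_exp_neg_mul_Ioi {x : ℝ} (hx : 0 < x) (m : ℕ) :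
    ∫ y in Ioi (0 : ℝ), y ^ m * Real.exp (-(x * y)) = m.factorial / x ^ (m + 1) := by
  have h := Real.integral_rpow_mul_exp_neg_mul_Ioi (a := m + 1) (by positivity) hx
  rw [Real.Gamma_nat_eq_factorial] at h
  simp only [add_sub_cancel_right, Real.rpow_natCast] at h
  rw [h, ← Nat.cast_succ, Real.rpow_natCast, one_div, inv_pow, inv_mul_eq_div]

open MeasureTheory Set in
theorem integrableOn_pow_mul_exp_neg_mul_Ioi {x : ℝ} (hx : 0 < x) (m : ℕ) :
    IntegrableOn (fun y : ℝ => y ^ m * Real.exp (-(x * y))) (Ioi 0) := by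
  have h := integrableOn_rpow_mul_exp_neg_mul_rpow (s := m) (p := 1) (b := x)
    (by linarith [(Nat.cast_nonneg m : (0 : ℝ) ≤ m)]) one_pos hx
  simpa [neg_mul] using h

/-- A finite set of positive integers contains at most `exp y` elements whose logarithm is below
`y`. -/
theorem card_filter_log_lt_le_exp (u : Finset ℕ+) (y : ℝ) :
    ((u.filter fun n : ℕ+ => Real.log n < y).card : ℝ) ≤ Real.exp y := by
  have h : (u.filter fun n : ℕ+ => Real.log n < y).card ≤ (Finset.Icc 1 ⌊Real.exp y⌋₊).card := by
    refine Finset.card_le_card_of_injOn (fun n => (n : ℕ)) (fun n hn => ?_)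
      PNat.coe_injective.injOn
    have hn' : Real.log n < y := by simpa using (Finset.mem_filter.mp hn).2
    have hpos : (0 : ℝ) < n := by exact_mod_cast n.pos
    simp only [Finset.coe_Icc, Set.mem_Icc]
    exact ⟨n.pos, Nat.le_floor ((Real.log_lt_iff_lt_exp hpos).mp hn').le⟩
  rw [Nat.card_Icc, Nat.add_sub_cancel] at h
  exact (Nat.cast_le.mpr h).trans (Nat.floor_le (Real.exp_pos y).le)

open MeasureTheory Set in
theorem rpow_mul_log_pow_le_integral {x : ℝ} (hx : 0 < x) (m : ℕ) (n : ℕ+) :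
    (n : ℝ) ^ (-x) * Real.log n ^ m ≤
      x * ∫ y in Ioi (Real.log n), y ^ m * Real.exp (-(x * y)) := by
  have hpos : (0 : ℝ) < n := by exact_mod_cast n.pos
  have hlog : 0 ≤ Real.log n := Real.log_natCast_nonneg n
  have hexp := integral_exp_mul_Ioi (a := -x) (by linarith) (Real.log n)
  have hint := integrableOn_exp_mul_Ioi (a := -x) (by linarith) (Real.log n)
  simp only [neg_mul] at hexp hint
  have hmono : ∫ y in Ioi (Real.log n), Real.log n ^ m * Real.exp (-(x * y)) ≤
      ∫ y in Ioi (Real.log n), y ^ m * Real.exp (-(x * y)) := by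
    refine setIntegral_mono_on (hint.const_mul _)
      ((integrableOn_pow_mul_exp_neg_mul_Ioi hx m).mono_set (Ioi_subset_Ioi hlog))
      measurableSet_Ioi fun y hy => ?_
    have hy' : Real.log n ≤ y := le_of_lt hy
    gcongr
  rw [integral_const_mul, hexp] at hmono
  calc (n : ℝ) ^ (-x) * Real.log n ^ m
      = x * (Real.log n ^ m * (-Real.exp (-(x * Real.log n)) / -x)) := by
        rw [Real.rpow_def_of_pos hpos, show Real.log n * -x = -(x * Real.log n) by ring]
        field_simp
    _ ≤ _ := by gcongr

open MeasureTheory Set in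
theorem sum_rpow_mul_log_pow_le {x : ℝ} (hx : 0 < x) (m : ℕ) (u : Finset ℕ+) :
    ∑ n ∈ u, (n : ℝ) ^ (-(1 + x)) * Real.log n ^ m ≤
      (1 + x) * (m.factorial / x ^ (m + 1)) := by
  have hx1 : 0 < 1 + x := by linarith
  set g : ℝ → ℝ := fun y => y ^ m * Real.exp (-((1 + x) * y)) with hg
  have hgi : IntegrableOn g (Ioi 0) := integrableOn_pow_mul_exp_neg_mul_Ioi hx1 m
  have hind (n : ℕ+) : ∫ y in Ioi (Real.log n), g y =
      ∫ y in Ioi (0 : ℝ), (Ioi (Real.log n)).indicator g y := by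
    rw [setIntegral_indicator measurableSet_Ioi, inter_eq_right.mpr
      (Ioi_subset_Ioi (Real.log_natCast_nonneg n))]
  have hii (n : ℕ+) : IntegrableOn ((Ioi (Real.log n)).indicator g) (Ioi 0) :=
    hgi.indicator measurableSet_Ioi
  calc ∑ n ∈ u, (n : ℝ) ^ (-(1 + x)) * Real.log n ^ m
      ≤ ∑ n ∈ u, (1 + x) * ∫ y in Ioi (Real.log n), g y :=
        Finset.sum_le_sum fun n _ => rpow_mul_log_pow_le_integral hx1 m n
    _ = (1 + x) * ∫ y in Ioi (0 : ℝ), ∑ n ∈ u, (Ioi (Real.log n)).indicator g y := by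
        rw [integral_finsetSum _ fun n _ => hii n, Finset.mul_sum]
        simp only [hind]
    _ ≤ (1 + x) * ∫ y in Ioi (0 : ℝ), y ^ m * Real.exp (-(x * y)) := by
        refine mul_le_mul_of_nonneg_left ?_ hx1.le
        refine setIntegral_mono_on (integrable_finsetSum _ fun n _ => hii n)
          (integrableOn_pow_mul_exp_neg_mul_Ioi hx m) measurableSet_Ioi fun y hy => ?_
        have hy0 : 0 < y := hy
        have hcard : ∑ n ∈ u, (Ioi (Real.log n)).indicator g y =
            (u.filter fun n : ℕ+ => Real.log n < y).card * g y := by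
          simp [indicator_apply, ← Finset.sum_filter]
        rw [hcard]
        calc _ ≤ Real.exp y * g y :=
              mul_le_mul_of_nonneg_right (card_filter_log_lt_le_exp u y) (by positivity)
          _ = y ^ m * Real.exp (-(x * y)) := by
              rw [hg, show -(x * y) = y + -((1 + x) * y) by ring, Real.exp_add]
              ring
    _ = _ := by rw [integral_pow_mul_exp_neg_mul_Ioi hx m]

/-- Cauchy–Schwarz for the series `∑ a i * w i` with square-summable factors. -/
theorem norm_tsum_mul_sq_le {ι : Type*} (a w : ι → ℂ) (ha : Summable fun i => ‖a i‖ ^ 2)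
    (hw : Summable fun i => ‖w i‖ ^ 2) :
    ‖∑' i, a i * w i‖ ^ 2 ≤ (∑' i, ‖a i‖ ^ 2) * ∑' i, ‖w i‖ ^ 2 := by
  have h := Real.summable_and_inner_le_Lp_mul_Lq_tsum_of_nonneg (p := 2) (q := 2)
    Real.HolderConjugate.two_two (fun i => norm_nonneg (a i)) (fun i => norm_nonneg (w i))
    (by simpa using ha) (by simpa using hw)
  simp only [Real.rpow_two, ← Real.sqrt_eq_rpow, ← norm_mul] at h
  have hA : 0 ≤ ∑' i, ‖a i‖ ^ 2 := tsum_nonneg fun i => by positivity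
  have hW : 0 ≤ ∑' i, ‖w i‖ ^ 2 := tsum_nonneg fun i => by positivity
  calc _ ≤ (√(∑' i, ‖a i‖ ^ 2) * √(∑' i, ‖w i‖ ^ 2)) ^ 2 := by
        gcongr
        exact (norm_tsum_le_tsum_norm h.1).trans h.2
    _ = _ := by rw [mul_pow, Real.sq_sqrt hA, Real.sq_sqrt hW]

theorem factorial_two_mul_add_two_le (j : ℕ) :
    ((2 * j + 2).factorial : ℝ) ≤ 4 ^ j * (j.factorial : ℝ) ^ 2 * (2 * j + 2) ^ 2 := by
  have h1 : (2 * j).factorial ≤ 4 ^ j * j.factorial ^ 2 := by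
    have h := Nat.choose_mul_factorial_mul_factorial (show j ≤ 2 * j by omega)
    rw [show 2 * j - j = j by omega] at h
    have h2 := Nat.choose_le_two_pow (2 * j) j
    rw [pow_mul] at h2
    rw [← h, mul_assoc, ← sq]
    exact Nat.mul_le_mul_right _ h2
  have h2 : (2 * j + 2).factorial ≤ 4 ^ j * j.factorial ^ 2 * (2 * j + 2) ^ 2 := by
    rw [Nat.factorial_succ, Nat.factorial_succ]
    calc _ ≤ (2 * j + 2) * ((2 * j + 2) * (4 ^ j * j.factorial ^ 2)) := by gcongr; omega
      _ = _ := by ring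
  exact_mod_cast h2

theorem norm_log_power_coeff_sq_le {c₁ c₂ : ℝ} (hc : 0 < 2 * c₁ - 1) (a : ℕ+ → ℂ)
    (ha : Summable (fun n : ℕ+ => ‖a n‖ ^ 2)) (j : ℕ) :
    ‖((-c₂ : ℂ) ^ j / (j.factorial : ℂ)) *
        ∑' n : ℕ+, a n * (((n : ℝ) ^ (-c₁) : ℝ) : ℂ) * ((Real.log n : ℂ)) ^ (j + 1)‖ ^ 2 ≤
      2 * c₁ / (2 * c₁ - 1) ^ 3 *
        ((2 * c₂ / (2 * c₁ - 1)) ^ (2 * j) * (2 * (j : ℝ) + 2) ^ 2 * ∑' n : ℕ+, ‖a n‖ ^ 2) := by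
  set w : ℕ+ → ℂ := fun n => (((n : ℝ) ^ (-c₁) : ℝ) : ℂ) * ((Real.log n : ℂ)) ^ (j + 1) with hw
  have hwsq (n : ℕ+) : ‖w n‖ ^ 2 =
      (n : ℝ) ^ (-(1 + (2 * c₁ - 1))) * Real.log n ^ (2 * j + 2) := by
    have hpos : (0 : ℝ) < n := by exact_mod_cast n.pos
    rw [hw, norm_mul, norm_pow, Complex.norm_real, Complex.norm_real,
      Real.norm_of_nonneg (Real.log_natCast_nonneg n), Real.norm_of_nonneg (by positivity),
      mul_pow, ← pow_mul, ← Real.rpow_mul_natCast hpos.le]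
    congr 2
    · push_cast; ring
    · ring
  have hnn : 0 ≤ fun n => ‖w n‖ ^ 2 := fun n => by positivity
  have hsum (u : Finset ℕ+) : ∑ n ∈ u, ‖w n‖ ^ 2 ≤
      (1 + (2 * c₁ - 1)) * ((2 * j + 2).factorial / (2 * c₁ - 1) ^ (2 * j + 2 + 1)) := by
    simp only [hwsq]
    exact sum_rpow_mul_log_pow_le hc (2 * j + 2) u
  have hcs := norm_tsum_mul_sq_le a w ha (summable_of_sum_le hnn hsum)
  have hS : 0 ≤ ∑' n, ‖a n‖ ^ 2 := tsum_nonneg fun n => by positivity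
  have hj : (0 : ℝ) < j.factorial := by exact_mod_cast j.factorial_pos
  have hc₁ : 0 < c₁ := by linarith
  simp only [mul_assoc (a _)]
  rw [norm_mul, mul_pow, norm_div, norm_pow, norm_neg, Complex.norm_real, Complex.norm_natCast,
    div_pow, ← pow_mul, mul_comm j 2, pow_mul, Real.norm_eq_abs, sq_abs, ← pow_mul]
  have hc₂ : 0 ≤ c₂ ^ (2 * j) := by rw [pow_mul]; positivity
  calc _ ≤ c₂ ^ (2 * j) / (j.factorial : ℝ) ^ 2 * ((∑' n, ‖a n‖ ^ 2) *
        ((1 + (2 * c₁ - 1)) * ((4 ^ j * (j.factorial : ℝ) ^ 2 * (2 * j + 2) ^ 2) /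
          (2 * c₁ - 1) ^ (2 * j + 2 + 1)))) := by
        gcongr
        refine hcs.trans (mul_le_mul_of_nonneg_left ?_ hS)
        refine (Real.tsum_le_of_sum_le hnn hsum).trans ?_
        have : 0 ≤ 1 + (2 * c₁ - 1) := by linarith
        gcongr
        exact factorial_two_mul_add_two_le j
    _ = _ := by
        rw [div_pow, mul_pow, pow_mul 2 2 j, show 2 * j + 2 + 1 = 2 * j + 3 by ring, pow_add]
        norm_num
        field_simp

theorem summable_geometric_mul_sq {r : ℝ} (hr0 : 0 ≤ r) (hr : r < 1) :
    Summable fun j : ℕ => r ^ (2 * j) * (2 * (j : ℝ) + 2) ^ 2 := by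
  have hq : ‖r ^ 2‖ < 1 := by
    rw [Real.norm_of_nonneg (by positivity)]
    exact pow_lt_one₀ hr0 hr two_ne_zero
  have h := (((summable_pow_mul_geometric_of_norm_lt_one 2 hq).mul_left 4).add
    ((summable_pow_mul_geometric_of_norm_lt_one 1 hq).mul_left 8)).add
    ((summable_pow_mul_geometric_of_norm_lt_one 0 hq).mul_left 4)
  refine h.congr fun j => ?_
  rw [pow_mul]
  ring


/-- Let `c₁, c₂ > 0` with `2c₁ - 2c₂ - 1 > 0`, and let `f = ∑ aₙ n^{-s}` with
`∑|aₙ|² < ∞`. For `k ≥ 0` set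
`b_k = ((-c₂)^k / k!) · ∑ₙ aₙ n^{-c₁} (log n)^{k+1}`. Then for every `N ≥ 0`,
`∑_{k=N}^∞ |b_k|² ≤ (2c₁/(2c₁-1)³) · ∑_{k=N}^∞ (2c₂/(2c₁-1))^{2k} (2k+2)²
  · ∑ₙ |aₙ|²`. -/
theorem tail_coeff_bound (c₁ c₂ : ℝ) (hc₁ : 0 < c₁) (hc₂ : 0 < c₂)
    (h : 0 < 2 * c₁ - 2 * c₂ - 1) (a : ℕ+ → ℂ)
    (ha : Summable (fun n : ℕ+ => ‖a n‖ ^ 2)) (N : ℕ) :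
    ∑' k : ℕ, ‖((-c₂ : ℂ) ^ (N + k) / ((N + k).factorial : ℂ)) *
        ∑' n : ℕ+, a n * (((n : ℝ) ^ (-c₁) : ℝ) : ℂ) *
          ((Real.log n : ℂ)) ^ (N + k + 1)‖ ^ 2 ≤
      2 * c₁ / (2 * c₁ - 1) ^ 3 *
        ∑' k : ℕ, ((2 * c₂ / (2 * c₁ - 1)) ^ (2 * (N + k)) *
          (2 * (N + k : ℝ) + 2) ^ 2) * ∑' n : ℕ+, ‖a n‖ ^ 2 := by
  have hc : 0 < 2 * c₁ - 1 := by linarith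
  have hr : 2 * c₂ / (2 * c₁ - 1) < 1 := by rw [div_lt_one hc]; linarith
  have hbound (k : ℕ) := norm_log_power_coeff_sq_le (c₂ := c₂) hc a ha (N + k)
  have hsummable := ((((summable_geometric_mul_sq (by positivity) hr).comp_injective
    (add_right_injective N)).mul_right (∑' n : ℕ+, ‖a n‖ ^ 2)).mul_left
      (2 * c₁ / (2 * c₁ - 1) ^ 3))
  simp only [Function.comp_apply, Nat.cast_add] at hbound hsummable
  rw [← tsum_mul_left]
  exact (hsummable.of_nonneg_of_le (fun k => by positivity) hbound).tsum_le_tsum hbound hsummable
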